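/- arXiv:1609.07438 — 10 statements merged into one kernel-verified Lean document; each statement's English description precedes it below -/
import Mathlib

section
/- For every real number α, the antisymmetric 4×4 matrix-valued map Π_α on ℝ^4 with entries (Π_α)_{12}(x) = (α/4)x₄ − ((1−α)/2)x₃, (Π_α)_{13}(x) = ((1−α)/2)x₂, (Π_α)_{23}(x) = −(α/2)x₁, and all entries in the fourth row and column equal to 0, satisfies the coordinate Jacobi identity: for all indices i,j,k ∈ {1,2,3,4} and all x ∈ ℝ^4, ∑_{l=1}^{4} ( (Π_α)_{li}(x) ∂_l (Π_α)_{jk}(x) + (Π_α)_{lj}(x) ∂_l (Π_α)_{ki}(x) + (Π_α)_{lk}(x) ∂_l (Π_α)_{ij}(x) ) = 0. In particular the two linear Poisson structures Π₀ (α=0) and Π₁ (α=1) on ℝ^4 are compatible. -/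
/-- Partial derivative ∂_l of a real-valued function on ℝⁿ at x. -/
noncomputable def pd {n : ℕ} (f : (Fin n → ℝ) → ℝ) (l : Fin n) (x : Fin n → ℝ) : ℝ :=
  fderiv ℝ f x (Pi.single l 1)

/-- The pencil Π_α of linear Poisson structures on ℝ⁴ (coordinates x₁,…,x₄ are
`x 0, …, x 3`): (Π_α)₁₂ = (α/4)x₄ − ((1−α)/2)x₃, (Π_α)₁₃ = ((1−α)/2)x₂,
(Π_α)₂₃ = −(α/2)x₁, fourth row and column zero, antisymmetric. -/
noncomputable def PiAlpha (α : ℝ) (x : Fin 4 → ℝ) : Matrix (Fin 4) (Fin 4) ℝ :=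
  !![0, α / 4 * x 3 - (1 - α) / 2 * x 2, (1 - α) / 2 * x 1, 0;
     -(α / 4 * x 3 - (1 - α) / 2 * x 2), 0, -(α / 2) * x 0, 0;
     -((1 - α) / 2 * x 1), α / 2 * x 0, 0, 0;
     0, 0, 0, 0]

/-- The partial derivatives of a linear function are its values on the standard basis. -/
theorem pd_of_isLinearMap {n : ℕ} {f : (Fin n → ℝ) → ℝ} (hf : IsLinearMap ℝ f)
    (l : Fin n) (x : Fin n → ℝ) : pd f l x = f (Pi.single l 1) := by
  have h : HasFDerivAt f (LinearMap.toContinuousLinearMap (hf.mk' f)) x :=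
    (LinearMap.toContinuousLinearMap (hf.mk' f)).hasFDerivAt
  rw [pd, h.fderiv]
  rfl

theorem isLinearMap_PiAlpha (α : ℝ) (i j : Fin 4) :
    IsLinearMap ℝ (fun x => PiAlpha α x i j) := by
  constructor <;> intros <;> fin_cases i <;> fin_cases j <;> simp [PiAlpha] <;> ring

/-- For every α, Π_α satisfies the coordinate Jacobi identity; in particular the
linear Poisson structures Π₀ (α = 0) and Π₁ (α = 1) are compatible. -/
theorem pencil_jacobi (α : ℝ) (i j k : Fin 4) (x : Fin 4 → ℝ) :
    ∑ l : Fin 4,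
      (PiAlpha α x l i * pd (fun y => PiAlpha α y j k) l x
        + PiAlpha α x l j * pd (fun y => PiAlpha α y k i) l x
        + PiAlpha α x l k * pd (fun y => PiAlpha α y i j) l x) = 0 := by
  simp only [pd_of_isLinearMap (isLinearMap_PiAlpha α _ _), Fin.sum_univ_four]
  fin_cases i <;> fin_cases j <;> fin_cases k <;> simp [PiAlpha]
end

section
/- Let Π₀ and Π₁ be the antisymmetric 4×4 matrix-valued maps on ℝ^4 with nonzero upper-triangular entries (Π₀)_{12}(x) = −x₃/2, (Π₀)_{13}(x) = x₂/2 and (Π₁)_{12}(x) = x₄/4, (Π₁)_{23}(x) = −x₁/2 respectively (all other upper-triangular entries zero), and let H₀(x) = x₃x₄ − x₁², H₁(x) = x₂² + x₃². Then for every x ∈ ℝ^4, Π₀(x)∇H₀(x) = Π₁(x)∇H₁(x) = (x₂x₄/2, −x₁x₃, x₁x₂, 0); that is, the dynamical system ẋ₁ = x₂x₄/2, ẋ₂ = −x₁x₃, ẋ₃ = x₁x₂, ẋ₄ = 0 is bi-Hamiltonian with respect to (Π₀, H₀) and (Π₁, H₁). -/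
/-- Gradient of a real-valued function on ℝⁿ at x. -/
noncomputable def grad {n : ℕ} (f : (Fin n → ℝ) → ℝ) (x : Fin n → ℝ) : Fin n → ℝ :=
  fun l => pd f l x

/-- Π₀ on ℝ⁴: (Π₀)₁₂ = −x₃/2, (Π₀)₁₃ = x₂/2, all other upper-triangular entries zero. -/
noncomputable def Pi0 (x : Fin 4 → ℝ) : Matrix (Fin 4) (Fin 4) ℝ :=
  !![0, -(x 2) / 2, x 1 / 2, 0;
     x 2 / 2, 0, 0, 0;
     -(x 1) / 2, 0, 0, 0;
     0, 0, 0, 0]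

/-- Π₁ on ℝ⁴: (Π₁)₁₂ = x₄/4, (Π₁)₂₃ = −x₁/2, all other upper-triangular entries zero. -/
noncomputable def Pi1 (x : Fin 4 → ℝ) : Matrix (Fin 4) (Fin 4) ℝ :=
  !![0, x 3 / 4, 0, 0;
     -(x 3) / 4, 0, -(x 0) / 2, 0;
     0, x 0 / 2, 0, 0;
     0, 0, 0, 0]

/-- H₀(x) = x₃x₄ − x₁². -/
noncomputable def H0 (x : Fin 4 → ℝ) : ℝ := x 2 * x 3 - (x 0) ^ 2

/-- H₁(x) = x₂² + x₃². -/
noncomputable def H1 (x : Fin 4 → ℝ) : ℝ := (x 1) ^ 2 + (x 2) ^ 2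

theorem grad_H0 (x : Fin 4 → ℝ) : grad H0 x = ![-(2 * x 0), 0, x 3, x 2] := by
  have hp (i : Fin 4) : HasFDerivAt (fun y : Fin 4 → ℝ => y i)
      (ContinuousLinearMap.proj (R := ℝ) (φ := fun _ : Fin 4 => ℝ) i) x := hasFDerivAt_apply i x
  have h : HasFDerivAt H0 _ x := ((hp 2).mul (hp 3)).sub ((hp 0).pow 2)
  ext l
  simp only [grad, pd, h.fderiv]
  fin_cases l <;> simp

theorem grad_H1 (x : Fin 4 → ℝ) : grad H1 x = ![0, 2 * x 1, 2 * x 2, 0] := by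
  have hp (i : Fin 4) : HasFDerivAt (fun y : Fin 4 → ℝ => y i)
      (ContinuousLinearMap.proj (R := ℝ) (φ := fun _ : Fin 4 => ℝ) i) x := hasFDerivAt_apply i x
  have h : HasFDerivAt H1 _ x := ((hp 1).pow 2).add ((hp 2).pow 2)
  ext l
  simp only [grad, pd, h.fderiv]
  fin_cases l <;> simp

/-- The system ẋ₁ = x₂x₄/2, ẋ₂ = −x₁x₃, ẋ₃ = x₁x₂, ẋ₄ = 0 is bi-Hamiltonian with
respect to (Π₀, H₀) and (Π₁, H₁). -/
theorem lorenz_biHamiltonian (x : Fin 4 → ℝ) :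
    Matrix.mulVec (Pi0 x) (grad H0 x) = ![x 1 * x 3 / 2, -(x 0 * x 2), x 0 * x 1, 0] ∧
    Matrix.mulVec (Pi1 x) (grad H1 x) = ![x 1 * x 3 / 2, -(x 0 * x 2), x 0 * x 1, 0] := by
  rw [grad_H0, grad_H1]
  constructor <;> ext l <;> fin_cases l <;>
    simp [Pi0, Pi1, Matrix.mulVec, dotProduct, Fin.sum_univ_four] <;> ring
end

section
/- For every real α and every real η ≠ 0, the antisymmetric 4×4 matrix-valued map Π_{αη} on ℝ^4 with entries (Π_{αη})_{12}(x) = (α/4)·sin(ηx₄)/η − (1−α)x₃/2, (Π_{αη})_{13}(x) = (1−α)x₂/2 + (α/4)·(cos(ηx₄)−1)/η, (Π_{αη})_{23}(x) = −(α/2)x₁, with all entries in the fourth row and column equal to 0, satisfies the coordinate Jacobi identity: for all i,j,k ∈ {1,2,3,4} and all x ∈ ℝ^4, ∑_{l=1}^{4} ( (Π_{αη})_{li}(x) ∂_l (Π_{αη})_{jk}(x) + (Π_{αη})_{lj}(x) ∂_l (Π_{αη})_{ki}(x) + (Π_{αη})_{lk}(x) ∂_l (Π_{αη})_{ij}(x)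 ) = 0. In particular the deformed structures Π_{0η} (α=0) and Π_{1η} (α=1) are compatible Poisson structures on ℝ^4. -/
open Real

/-- The deformed pencil Π_{αη} of multiplicative Poisson structures on ℝ⁴:
(Π_{αη})₁₂ = (α/4)·sin(ηx₄)/η − (1−α)x₃/2,
(Π_{αη})₁₃ = (1−α)x₂/2 + (α/4)·(cos(ηx₄)−1)/η,
(Π_{αη})₂₃ = −(α/2)x₁, fourth row and column zero, antisymmetric. -/
noncomputable def PiAlphaEta (α η : ℝ) (x : Fin 4 → ℝ) : Matrix (Fin 4) (Fin 4) ℝ :=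
  !![0, α / 4 * sin (η * x 3) / η - (1 - α) * x 2 / 2,
        (1 - α) * x 1 / 2 + α / 4 * (cos (η * x 3) - 1) / η, 0;
     -(α / 4 * sin (η * x 3) / η - (1 - α) * x 2 / 2), 0, -(α / 2) * x 0, 0;
     -((1 - α) * x 1 / 2 + α / 4 * (cos (η * x 3) - 1) / η), α / 2 * x 0, 0, 0;
     0, 0, 0, 0]

theorem pd_const {n : ℕ} (c : ℝ) (l : Fin n) (x : Fin n → ℝ) : pd (fun _ => c) l x = 0 := by
  simp [pd]

theorem pd_neg {n : ℕ} (f : (Fin n → ℝ) → ℝ) (l : Fin n) (x : Fin n → ℝ) :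
    pd (fun y => -f y) l x = -pd f l x := by
  simp [pd, fderiv_fun_neg]

theorem pd_const_mul_coord {n : ℕ} (c : ℝ) (m l : Fin n) (x : Fin n → ℝ) :
    pd (fun y => c * y m) l x = c * (Pi.single l 1 : Fin n → ℝ) m := by
  have h : HasFDerivAt (fun y : Fin n → ℝ => c * y m)
      (c • ContinuousLinearMap.proj (R := ℝ) (φ := fun _ : Fin n => ℝ) m) x :=
    (hasFDerivAt_apply m x).const_mul c
  simp [pd, h.fderiv]

/-- The partial derivatives of the entry `(Π_{αη})₁₂`. -/
theorem pd_entry_one_two (α η : ℝ) (hη : η ≠ 0) (l : Fin 4) (x : Fin 4 → ℝ) :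
    pd (fun y => α / 4 * sin (η * y 3) / η - (1 - α) * y 2 / 2) l x
      = α / 4 * cos (η * x 3) * (Pi.single l 1 : Fin 4 → ℝ) 3
        - (1 - α) / 2 * (Pi.single l 1 : Fin 4 → ℝ) 2 := by
  have h3 := (hasFDerivAt_apply (𝕜 := ℝ) (F' := fun _ : Fin 4 => ℝ) 3 x).const_mul η
  have h2 := (hasFDerivAt_apply (𝕜 := ℝ) (F' := fun _ : Fin 4 => ℝ) 2 x).const_mul (1 - α)
  have h := ((h3.sin.const_mul (α / 4)).mul_const η⁻¹).sub (h2.mul_const (2 : ℝ)⁻¹)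
  simp only [div_eq_mul_inv _ η, div_eq_mul_inv _ (2 : ℝ)]
  refine (congrArg (fun L => L (Pi.single l 1)) h.fderiv).trans ?_
  simp
  field_simp

/-- The partial derivatives of the entry `(Π_{αη})₁₃`. -/
theorem pd_entry_one_three (α η : ℝ) (hη : η ≠ 0) (l : Fin 4) (x : Fin 4 → ℝ) :
    pd (fun y => (1 - α) * y 1 / 2 + α / 4 * (cos (η * y 3) - 1) / η) l x
      = (1 - α) / 2 * (Pi.single l 1 : Fin 4 → ℝ) 1
        - α / 4 * sin (η * x 3) * (Pi.single l 1 : Fin 4 → ℝ) 3 := by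
  have h3 := (hasFDerivAt_apply (𝕜 := ℝ) (F' := fun _ : Fin 4 => ℝ) 3 x).const_mul η
  have h1 := (hasFDerivAt_apply (𝕜 := ℝ) (F' := fun _ : Fin 4 => ℝ) 1 x).const_mul (1 - α)
  have h := (h1.mul_const (2 : ℝ)⁻¹).add
    (((h3.cos.sub_const 1).const_mul (α / 4)).mul_const η⁻¹)
  simp only [div_eq_mul_inv _ η, div_eq_mul_inv _ (2 : ℝ)]
  refine (congrArg (fun L => L (Pi.single l 1)) h.fderiv).trans ?_
  simp
  field_simp
  ring

/-- For every α and η ≠ 0, the deformed structure Π_{αη} satisfies the coordinate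
Jacobi identity; in particular Π_{0η} and Π_{1η} are compatible Poisson structures. -/
theorem deformed_pencil_jacobi (α η : ℝ) (hη : η ≠ 0) (i j k : Fin 4) (x : Fin 4 → ℝ) :
    ∑ l : Fin 4,
      (PiAlphaEta α η x l i * pd (fun y => PiAlphaEta α η y j k) l x
        + PiAlphaEta α η x l j * pd (fun y => PiAlphaEta α η y k i) l x
        + PiAlphaEta α η x l k * pd (fun y => PiAlphaEta α η y i j) l x) = 0 := by
  fin_cases i <;> fin_cases j <;> fin_cases k <;>
    simp [PiAlphaEta, Fin.sum_univ_four, pd_const, -neg_sub, -neg_add_rev, pd_neg,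
      pd_const_mul_coord, pd_entry_one_two α η hη, pd_entry_one_three α η hη, -neg_mul]
end

section
/- Fix reals α and η ≠ 0. Let m : ℝ^4 × ℝ^4 → ℝ^4 be the group multiplication m(y,z) = ( y₁+z₁, y₂ + z₂cos(ηy₄) + z₃sin(ηy₄), y₃ − z₂sin(ηy₄) + z₃cos(ηy₄), y₄+z₄ ), and let Π_{αη} be the antisymmetric 4×4 matrix-valued map on ℝ^4 with entries (Π_{αη})_{12}(x) = (α/4)sin(ηx₄)/η − (1−α)x₃/2, (Π_{αη})_{13}(x) = (1−α)x₂/2 + (α/4)(cos(ηx₄)−1)/η, (Π_{αη})_{23}(x) = −(α/2)x₁, fourth row and column zero. Then for all (y,z) ∈ ℝ^4 × ℝ^4, writing J(y,z) for the 4×8 Jacobian matrix of m at (y,z), one has J(y,z) · ( Π_{αη}(y) ⊕ Π_{αη}(z) ) · J(y,z)ᵀ = Π_{αη}( m(y,z) ), where Π_{αη}(y) ⊕ Π_{αη}(z) denotes the 8×8 block-diagonal matrix with blocks Π_{αη}(y) and Π_{αη}(z). That is, m is a Poisson map from the product structure to Π_{αη}, i.e. Π_{αη} is multiplicative. -/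
open Real Matrix

/-- The multiplication of the group G_η on ℝ⁴. -/
noncomputable def mulEta (η : ℝ) (a b : Fin 4 → ℝ) : Fin 4 → ℝ :=
  ![a 0 + b 0,
    a 1 + b 1 * cos (η * a 3) + b 2 * sin (η * a 3),
    a 2 - b 1 * sin (η * a 3) + b 2 * cos (η * a 3),
    a 3 + b 3]

/-- The standard basis directions of ℝ⁴ × ℝ⁴, indexed by `Fin 4 ⊕ Fin 4`. -/
noncomputable def pbasis (d : Fin 4 ⊕ Fin 4) : (Fin 4 → ℝ) × (Fin 4 → ℝ) :=
  Sum.elim (fun j => (Pi.single j 1, 0)) (fun j => (0, Pi.single j 1)) d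

/-- The 4×8 Jacobian matrix of the multiplication m at (y,z). -/
noncomputable def jacMul (η : ℝ) (y z : Fin 4 → ℝ) : Matrix (Fin 4) (Fin 4 ⊕ Fin 4) ℝ :=
  Matrix.of fun i d =>
    fderiv ℝ (fun p : (Fin 4 → ℝ) × (Fin 4 → ℝ) => mulEta η p.1 p.2 i) (y, z) (pbasis d)

/-- The closed form of `jacMul`, in the block decomposition `ℝ⁴ × ℝ⁴`. -/
theorem jacMul_eq_fromCols (η : ℝ) (y z : Fin 4 → ℝ) :
    jacMul η y z = Matrix.fromCols
      !![1, 0, 0, 0;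
         0, 1, 0, η * (z 2 * cos (η * y 3) - z 1 * sin (η * y 3));
         0, 0, 1, -(η * (z 1 * cos (η * y 3) + z 2 * sin (η * y 3)));
         0, 0, 0, 1]
      !![1, 0, 0, 0;
         0, cos (η * y 3), sin (η * y 3), 0;
         0, -sin (η * y 3), cos (η * y 3), 0;
         0, 0, 0, 1] := by
  have hy (k : Fin 4) : HasFDerivAt (fun p : (Fin 4 → ℝ) × (Fin 4 → ℝ) => p.1 k)
      ((ContinuousLinearMap.proj k).comp (ContinuousLinearMap.fst ℝ _ _)) (y, z) :=
    ((ContinuousLinearMap.proj (R := ℝ) (φ := fun _ : Fin 4 => ℝ) k).comp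
      (ContinuousLinearMap.fst ℝ (Fin 4 → ℝ) (Fin 4 → ℝ))).hasFDerivAt
  have hz (k : Fin 4) : HasFDerivAt (fun p : (Fin 4 → ℝ) × (Fin 4 → ℝ) => p.2 k)
      ((ContinuousLinearMap.proj k).comp (ContinuousLinearMap.snd ℝ _ _)) (y, z) :=
    ((ContinuousLinearMap.proj (R := ℝ) (φ := fun _ : Fin 4 => ℝ) k).comp
      (ContinuousLinearMap.snd ℝ (Fin 4 → ℝ) (Fin 4 → ℝ))).hasFDerivAt
  have hc := ((hy 3).const_mul η).cos
  have hs := ((hy 3).const_mul η).sin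
  have h0 := (hy 0).add (hz 0)
  have h1 := ((hy 1).add ((hz 1).mul hc)).add ((hz 2).mul hs)
  have h2 := ((hy 2).sub ((hz 1).mul hs)).add ((hz 2).mul hc)
  have h3 := (hy 3).add (hz 3)
  have key (i : Fin 4) (d : Fin 4 ⊕ Fin 4)
      {L : (Fin 4 → ℝ) × (Fin 4 → ℝ) →L[ℝ] ℝ}
      (h : HasFDerivAt (fun p : (Fin 4 → ℝ) × (Fin 4 → ℝ) => mulEta η p.1 p.2 i) L (y, z)) :
      jacMul η y z i d = L (pbasis d) := by
    simp only [jacMul, Matrix.of_apply, h.fderiv]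
  ext i d
  fin_cases i
  · refine (key 0 d h0).trans ?_
    rcases d with j | j <;> fin_cases j <;> simp [pbasis]
  · refine (key 1 d h1).trans ?_
    rcases d with j | j <;> fin_cases j <;> simp [pbasis]
    ring
  · refine (key 2 d h2).trans ?_
    rcases d with j | j <;> fin_cases j <;> simp [pbasis]
    ring
  · refine (key 3 d h3).trans ?_
    rcases d with j | j <;> fin_cases j <;> simp [pbasis]

/-- The multiplication m is a Poisson map from the product structure
Π_{αη} ⊕ Π_{αη} on ℝ⁴ × ℝ⁴ to Π_{αη} on ℝ⁴: Π_{αη} is multiplicative. -/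
theorem PiAlphaEta_multiplicative (α η : ℝ) (hη : η ≠ 0) (y z : Fin 4 → ℝ) :
    jacMul η y z * Matrix.fromBlocks (PiAlphaEta α η y) 0 0 (PiAlphaEta α η z) *
        (jacMul η y z)ᵀ
      = PiAlphaEta α η (mulEta η y z) := by
  rw [jacMul_eq_fromCols, Matrix.transpose_fromCols, Matrix.fromCols_mul_fromBlocks,
    Matrix.fromCols_mul_fromRows]
  have h := sin_sq_add_cos_sq (η * y 3)
  ext i j
  simp only [Matrix.add_apply, Matrix.mul_apply, Fin.sum_univ_four, Matrix.transpose_apply]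
  fin_cases i <;> fin_cases j <;>
    simp [PiAlphaEta, mulEta, mul_add, sin_add, cos_add] <;>
    field_simp <;> grind
end

section
/- For each real η, let Ψ_η : ℝ^4 → (4×4 antisymmetric real matrices) be the linear map determined on the standard basis by Ψ_η(e₁) = 0, Ψ_η(e₂) = −η(e₃e₄ᵀ − e₄e₃ᵀ), Ψ_η(e₃) = η(e₂e₄ᵀ − e₄e₂ᵀ), Ψ_η(e₄) = 0 (the matrix of a bivector v∧w being vwᵀ − wvᵀ). For each real α let [·,·]_α be the bilinear antisymmetric bracket on ℝ^4 with [e₁,e₂]_α = (α/4)e₄ − ((1−α)/2)e₃, [e₁,e₃]_α = ((1−α)/2)e₂, [e₂,e₃]_α = −(α/2)e₁, and [v, e₄]_α = 0 for all v, and let ad^α_ξ denote the matrix of the linear map ζ ↦ [ξ,ζ]_α. Then for all α, η ∈ ℝ and all ξ, ζ ∈ ℝ^4: Ψ_η([ξ,ζ]_α) = ad^α_ξ Ψ_η(ζ) + Ψ_η(ζ)(ad^α_ξ)ᵀ − ad^α_ζ Ψ_η(ξ) − Ψ_η(ξ)(ad^α_ζ)ᵀ; that is, Ψ_η is a common adjoint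 1-cocycle for the whole family of Lie algebras (ℝ^4, [·,·]_α). -/
open Matrix

/-- The k-th standard basis vector of ℝ⁴ (so `e 0 = e₁`, …, `e 3 = e₄`). -/
noncomputable def e (k : Fin 4) : Fin 4 → ℝ := Pi.single k 1

/-- The antisymmetric matrix vwᵀ − wvᵀ of the bivector v ∧ w. -/
noncomputable def wedge (v w : Fin 4 → ℝ) : Matrix (Fin 4) (Fin 4) ℝ :=
  Matrix.vecMulVec v w - Matrix.vecMulVec w v

/-- The linear map Ψ_η : ℝ⁴ → Λ²ℝ⁴ determined by Ψ_η(e₁) = 0,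
Ψ_η(e₂) = −η e₃∧e₄, Ψ_η(e₃) = η e₂∧e₄, Ψ_η(e₄) = 0. -/
noncomputable def Psi (η : ℝ) (v : Fin 4 → ℝ) : Matrix (Fin 4) (Fin 4) ℝ :=
  v 1 • ((-η) • wedge (e 2) (e 3)) + v 2 • (η • wedge (e 1) (e 3))

/-- The bilinear antisymmetric bracket [·,·]_α on ℝ⁴ with
[e₁,e₂] = (α/4)e₄ − ((1−α)/2)e₃, [e₁,e₃] = ((1−α)/2)e₂, [e₂,e₃] = −(α/2)e₁,
and [v,e₄] = 0. -/
noncomputable def bra (α : ℝ) (v w : Fin 4 → ℝ) : Fin 4 → ℝ :=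
  (v 0 * w 1 - v 1 * w 0) • ((α / 4) • e 3 - ((1 - α) / 2) • e 2)
    + (v 0 * w 2 - v 2 * w 0) • (((1 - α) / 2) • e 1)
    + (v 1 * w 2 - v 2 * w 1) • ((-(α / 2)) • e 0)

/-- The matrix of the linear map ζ ↦ [ξ,ζ]_α. -/
noncomputable def ad (α : ℝ) (ξ : Fin 4 → ℝ) : Matrix (Fin 4) (Fin 4) ℝ :=
  Matrix.of fun i j => bra α ξ (e j) i

/-- Ψ_η is a common adjoint 1-cocycle for the whole family of Lie algebras
(ℝ⁴, [·,·]_α). -/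
theorem Psi_common_cocycle (α η : ℝ) (ξ ζ : Fin 4 → ℝ) :
    Psi η (bra α ξ ζ)
      = ad α ξ * Psi η ζ + Psi η ζ * (ad α ξ)ᵀ
        - ad α ζ * Psi η ξ - Psi η ξ * (ad α ζ)ᵀ := by
  ext i j
  fin_cases i <;> fin_cases j <;>
    simp [Psi, bra, ad, wedge, e, Matrix.mul_apply, Fin.sum_univ_four, Matrix.vecMulVec_apply,
      Pi.single_apply] <;> ring
end

section
/- Fix a real η ≠ 0. With Π_{0η}, Π_{1η} the antisymmetric 4×4 matrix-valued maps on ℝ^4 with nonzero upper-triangular entries (Π_{0η})_{12}(x) = −x₃/2, (Π_{0η})_{13}(x) = x₂/2 and (Π_{1η})_{12}(x) = sin(ηx₄)/(4η), (Π_{1η})_{13}(x) = (cos(ηx₄)−1)/(4η), (Π_{1η})_{23}(x) = −x₁/2, and with Hamiltonians H_{0η}(x) = (sin(ηx₄)/η)x₃ − ((cos(ηx₄)−1)/η)x₂ − x₁² and H_{1η}(x) = x₂² + x₃², one has for all x ∈ ℝ^4: Π_{0η}(x)∇H_{0η}(x) = Π_{1η}(x)∇H_{1η}(x) = F_η(x),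 where F_η(x) = ( (sin(ηx₄)/(2η))x₂ + ((cos(ηx₄)−1)/(2η))x₃, −x₁x₃, x₁x₂, 0 ). Hence the deformed Lorenz system ẋ = F_η(x) is bi-Hamiltonian with respect to (Π_{0η}, H_{0η}) and (Π_{1η}, H_{1η}). -/
open Real

/-- Π_{0η} on ℝ⁴. -/
noncomputable def Pi0Eta (η : ℝ) (x : Fin 4 → ℝ) : Matrix (Fin 4) (Fin 4) ℝ :=
  !![0, -(x 2) / 2, x 1 / 2, 0;
     x 2 / 2, 0, 0, 0;
     -(x 1) / 2, 0, 0, 0;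
     0, 0, 0, 0]

/-- Π_{1η} on ℝ⁴. -/
noncomputable def Pi1Eta (η : ℝ) (x : Fin 4 → ℝ) : Matrix (Fin 4) (Fin 4) ℝ :=
  !![0, sin (η * x 3) / (4 * η), (cos (η * x 3) - 1) / (4 * η), 0;
     -(sin (η * x 3) / (4 * η)), 0, -(x 0) / 2, 0;
     -((cos (η * x 3) - 1) / (4 * η)), x 0 / 2, 0, 0;
     0, 0, 0, 0]

/-- H_{0η}(x) = (sin(ηx₄)/η)x₃ − ((cos(ηx₄)−1)/η)x₂ − x₁². -/
noncomputable def H0Eta (η : ℝ) (x : Fin 4 → ℝ) : ℝ :=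
  sin (η * x 3) / η * x 2 - (cos (η * x 3) - 1) / η * x 1 - (x 0) ^ 2

/-- H_{1η}(x) = x₂² + x₃². -/
noncomputable def H1Eta (x : Fin 4 → ℝ) : ℝ := (x 1) ^ 2 + (x 2) ^ 2

/-- The deformed Lorenz vector field F_η on ℝ⁴. -/
noncomputable def FEta (η : ℝ) (x : Fin 4 → ℝ) : Fin 4 → ℝ :=
  ![sin (η * x 3) / (2 * η) * x 1 + (cos (η * x 3) - 1) / (2 * η) * x 2,
    -(x 0 * x 2), x 0 * x 1, 0]

theorem grad_H0Eta {η : ℝ} (hη : η ≠ 0) (x : Fin 4 → ℝ) :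
    grad (H0Eta η) x = ![-(2 * x 0), -((cos (η * x 3) - 1) / η), sin (η * x 3) / η,
      cos (η * x 3) * x 2 + sin (η * x 3) * x 1] := by
  have hx : ∀ i, HasFDerivAt (fun y : Fin 4 → ℝ => y i)
      (ContinuousLinearMap.proj (R := ℝ) (φ := fun _ : Fin 4 => ℝ) i) x :=
    fun i => hasFDerivAt_apply i x
  have hsin := ((hx 3).const_mul η).sin.mul_const η⁻¹
  have hcos := (((hx 3).const_mul η).cos.sub_const 1).mul_const η⁻¹
  have h : HasFDerivAt (H0Eta η) _ x :=
    ((hsin.mul (hx 2)).sub (hcos.mul (hx 1))).sub ((hx 0).pow 2)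
  ext l
  simp only [grad, pd, h.fderiv]
  fin_cases l <;> simp <;> field_simp

theorem grad_H1Eta (x : Fin 4 → ℝ) : grad H1Eta x = ![0, 2 * x 1, 2 * x 2, 0] := by
  have hx : ∀ i, HasFDerivAt (fun y : Fin 4 → ℝ => y i)
      (ContinuousLinearMap.proj (R := ℝ) (φ := fun _ : Fin 4 => ℝ) i) x :=
    fun i => hasFDerivAt_apply i x
  have h : HasFDerivAt H1Eta _ x := ((hx 1).pow 2).add ((hx 2).pow 2)
  ext l
  simp only [grad, pd, h.fderiv]
  fin_cases l <;> simp

/-- The deformed Lorenz system ẋ = F_η(x) is bi-Hamiltonian with respect to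
(Π_{0η}, H_{0η}) and (Π_{1η}, H_{1η}). -/
theorem deformed_lorenz_biHamiltonian (η : ℝ) (hη : η ≠ 0) (x : Fin 4 → ℝ) :
    Matrix.mulVec (Pi0Eta η x) (grad (H0Eta η) x) = FEta η x ∧
    Matrix.mulVec (Pi1Eta η x) (grad H1Eta x) = FEta η x := by
  rw [grad_H0Eta hη, grad_H1Eta]
  constructor <;> ext i <;> fin_cases i <;>
    simp [Pi0Eta, Pi1Eta, FEta, Matrix.mulVec, dotProduct, Fin.sum_univ_four] <;> field_simp <;> ring
end

section
/- Fix a real η ≠ 0 and let F_η : ℝ^4 → ℝ^4 be F_η(x) = ( (sin(ηx₄)/(2η))x₂ + ((cos(ηx₄)−1)/(2η))x₃, −x₁x₃, x₁x₂, 0 ). If x : ℝ → ℝ^4 is a differentiable curve with x'(t) = F_η(x(t)) for all t, then the functions t ↦ H_{0η}(x(t)) and t ↦ H_{1η}(x(t)) are constant, where H_{0η}(x) = (sin(ηx₄)/η)x₃ − ((cos(ηx₄)−1)/η)x₂ − x₁² and H_{1η}(x) = x₂² + x₃². -/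
open Real

/-- Along every differentiable solution of ẋ = F_η(x), the Hamiltonians H_{0η}
and H_{1η} are constants of motion. -/
theorem deformed_lorenz_first_integrals (η : ℝ) (hη : η ≠ 0)
    (x : ℝ → Fin 4 → ℝ) (hx : Differentiable ℝ x)
    (hode : ∀ t, deriv x t = FEta η (x t)) :
    (∀ s t : ℝ, H0Eta η (x s) = H0Eta η (x t)) ∧
    (∀ s t : ℝ, H1Eta (x s) = H1Eta (x t)) := by
  have hi : ∀ t i, HasDerivAt (fun u => x u i) (FEta η (x t) i) t := fun t =>
    hasDerivAt_pi.1 (hode t ▸ (hx t).hasDerivAt)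
  have h0 : ∀ t, HasDerivAt (fun u => x u 0)
      (sin (η * x t 3) / (2 * η) * x t 1 + (cos (η * x t 3) - 1) / (2 * η) * x t 2) t :=
    fun t => hi t 0
  have h1 : ∀ t, HasDerivAt (fun u => x u 1) (-(x t 0 * x t 2)) t := fun t => hi t 1
  have h2 : ∀ t, HasDerivAt (fun u => x u 2) (x t 0 * x t 1) t := fun t => hi t 2
  have h3 : ∀ t, HasDerivAt (fun u => x u 3) 0 t := fun t => hi t 3
  have const : ∀ f : ℝ → ℝ, (∀ t, HasDerivAt f 0 t) → ∀ s t, f s = f t := fun f hf =>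
    is_const_of_deriv_eq_zero (fun t => (hf t).differentiableAt) fun t => (hf t).deriv
  constructor
  · refine const (fun t => H0Eta η (x t)) fun t => ?_
    have hangle := (h3 t).const_mul η
    refine ((((hangle.sin.div_const η).mul (h2 t)).sub
      (((hangle.cos.sub_const 1).div_const η).mul (h1 t))).sub ((h0 t).pow 2)).congr_deriv ?_
    field_simp
    ring
  · refine const (fun t => H1Eta (x t)) fun t => ?_
    refine (((h1 t).pow 2).add ((h2 t).pow 2)).congr_deriv ?_
    ring
end

section
/- Fix a real η ≠ 0 and set H_{0η}(x) = (sin(ηx₄)/η)x₃ − ((cos(ηx₄)−1)/η)x₂ − x₁² and H_{1η}(x) = x₂² + x₃² on ℝ^4. Then the set U = { x ∈ ℝ^4 : ∇H_{0η}(x) and ∇H_{1η}(x) are linearly independent over ℝ } is open and dense in ℝ^4; i.e. the two Hamiltonians are functionally independent on a dense open subset of ℝ^4. -/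
open Real

theorem continuous_grad {n : ℕ} {f : (Fin n → ℝ) → ℝ} (hf : ContDiff ℝ 1 f) :
    Continuous (grad f) :=
  continuous_pi fun _ => (hf.continuous_fderiv one_ne_zero).clm_apply continuous_const

theorem grad_apply_eq_deriv {n : ℕ} {f : (Fin n → ℝ) → ℝ} {x : Fin n → ℝ}
    (hf : DifferentiableAt ℝ f x) (l : Fin n) :
    grad f x l = deriv (fun t : ℝ => f (x + t • Pi.single l 1)) 0 :=
  hf.lineDeriv_eq_fderiv.symm

theorem contDiff_H0Eta (η : ℝ) : ContDiff ℝ 1 (H0Eta η) := by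
  unfold H0Eta
  fun_prop

theorem contDiff_H1Eta : ContDiff ℝ 1 H1Eta := by
  unfold H1Eta
  fun_prop

theorem grad_H0Eta_zero (η : ℝ) (x : Fin 4 → ℝ) : grad (H0Eta η) x 0 = -(2 * x 0) := by
  rw [grad_apply_eq_deriv ((contDiff_H0Eta η).differentiable one_ne_zero x)]
  have h := (((hasDerivAt_id (0 : ℝ)).const_add (x 0)).pow 2).const_sub
    (sin (η * x 3) / η * x 2 - (cos (η * x 3) - 1) / η * x 1)
  simpa [H0Eta] using h.deriv

theorem grad_H1Eta_zero (x : Fin 4 → ℝ) : grad H1Eta x 0 = 0 := by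
  rw [grad_apply_eq_deriv (contDiff_H1Eta.differentiable one_ne_zero x)]
  simp [H1Eta]

theorem grad_H1Eta_one (x : Fin 4 → ℝ) : grad H1Eta x 1 = 2 * x 1 := by
  rw [grad_apply_eq_deriv (contDiff_H1Eta.differentiable one_ne_zero x)]
  have h := (((hasDerivAt_id (0 : ℝ)).const_add (x 1)).pow 2).add_const (x 2 ^ 2)
  simpa [H1Eta] using h.deriv

theorem linearIndependent_grad_H0Eta_H1Eta (η : ℝ) {x : Fin 4 → ℝ} (h0 : x 0 ≠ 0)
    (h1 : x 1 ≠ 0) : LinearIndependent ℝ ![grad (H0Eta η) x, grad H1Eta x] := by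
  rw [LinearIndependent.pair_iff]
  intro a b hab
  have ha : a = 0 := by
    simpa [grad_H0Eta_zero, grad_H1Eta_zero, h0] using congrFun hab 0
  subst ha
  exact ⟨rfl, by simpa [grad_H1Eta_one, h1] using congrFun hab 1⟩

theorem isOpen_setOf_apply_ne_zero {ι : Type*} (i : ι) : IsOpen {x : ι → ℝ | x i ≠ 0} :=
  isOpen_ne.preimage (continuous_apply i)

theorem dense_setOf_apply_ne_zero {ι : Type*} (i : ι) : Dense {x : ι → ℝ | x i ≠ 0} :=
  (dense_compl_singleton (0 : ℝ)).preimage (isOpenMap_eval i)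

/-- The set of points of ℝ⁴ where ∇H_{0η} and ∇H_{1η} are linearly independent is
open and dense: the two Hamiltonians are functionally independent on a dense open
subset of ℝ⁴. -/
theorem deformed_lorenz_functional_independence (η : ℝ) (hη : η ≠ 0) :
    IsOpen {x : Fin 4 → ℝ | LinearIndependent ℝ ![grad (H0Eta η) x, grad H1Eta x]} ∧
    Dense {x : Fin 4 → ℝ | LinearIndependent ℝ ![grad (H0Eta η) x, grad H1Eta x]} := by
  constructor
  · have hc : Continuous fun x => ![grad (H0Eta η) x, grad H1Eta x] :=
      (continuous_grad (contDiff_H0Eta η)).matrixVecCons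
        ((continuous_grad contDiff_H1Eta).matrixVecCons continuous_const)
    exact isOpen_setOfPred_linearIndependent.preimage hc
  · refine ((dense_setOf_apply_ne_zero (0 : Fin 4)).inter_of_isOpen_left
      (dense_setOf_apply_ne_zero 1) (isOpen_setOf_apply_ne_zero 0)).mono ?_
    rintro x ⟨h0, h1⟩
    exact linearIndependent_grad_H0Eta_H1Eta η h0 h1
end

section
/- Fix a real η ≠ 0. Let m : ℝ^4 × ℝ^4 → ℝ^4 be the group multiplication m(y,z) = ( y₁+z₁, y₂ + z₂cos(ηy₄) + z₃sin(ηy₄), y₃ − z₂sin(ηy₄) + z₃cos(ηy₄), y₄+z₄ ), let Π_{0η}, Π_{1η} be the antisymmetric 4×4 matrix-valued maps on ℝ^4 with nonzero upper-triangular entries (Π_{0η})_{12}(x) = −x₃/2, (Π_{0η})_{13}(x) = x₂/2 and (Π_{1η})_{12}(x) = sin(ηx₄)/(4η), (Π_{1η})_{13}(x) = (cos(ηx₄)−1)/(4η), (Π_{1η})_{23}(x) = −x₁/2, and set H_{0η}(x) = (sin(ηx₄)/η)x₃ − ((cos(ηx₄)−1)/η)x₂ − x₁², H_{1η}(x) =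 x₂² + x₃². Then for i = 0 and i = 1 and all (y,z) ∈ ℝ^4 × ℝ^4: ∇(H_{0η}∘m)(y,z)ᵀ · ( Π_{iη}(y) ⊕ Π_{iη}(z) ) · ∇(H_{1η}∘m)(y,z) = 0; that is, the coproducts H_{0η}∘m and H_{1η}∘m are in involution with respect to both product Poisson structures on ℝ^4 × ℝ^4. -/
open Real Matrix

/-- Gradient of a real-valued function on ℝ⁴ × ℝ⁴ at (y,z). -/
noncomputable def gradProd (K : (Fin 4 → ℝ) × (Fin 4 → ℝ) → ℝ)
    (p : (Fin 4 → ℝ) × (Fin 4 → ℝ)) : Fin 4 ⊕ Fin 4 → ℝ :=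
  fun d => fderiv ℝ K p (pbasis d)

/-- The Jacobian matrix of the group multiplication of G_η. -/
noncomputable def mulEtaJacobian (η : ℝ) (y z : Fin 4 → ℝ) :
    Matrix (Fin 4) (Fin 4 ⊕ Fin 4) ℝ :=
  Matrix.fromCols
    !![1, 0, 0, 0;
       0, 1, 0, η * (z 2 * cos (η * y 3) - z 1 * sin (η * y 3));
       0, 0, 1, -(η * (z 1 * cos (η * y 3) + z 2 * sin (η * y 3)));
       0, 0, 0, 1]
    !![1, 0, 0, 0;
       0, cos (η * y 3), sin (η * y 3), 0;
       0, -sin (η * y 3), cos (η * y 3), 0;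
       0, 0, 0, 1]

theorem hasFDerivAt_mulEta (η : ℝ) (y z : Fin 4 → ℝ) :
    ∃ L : (Fin 4 → ℝ) × (Fin 4 → ℝ) →L[ℝ] Fin 4 → ℝ,
      HasFDerivAt (fun p : (Fin 4 → ℝ) × (Fin 4 → ℝ) => mulEta η p.1 p.2) L (y, z) ∧
      ∀ i d, L (pbasis d) i = mulEtaJacobian η y z i d := by
  have hY (i : Fin 4) : HasFDerivAt (fun p : (Fin 4 → ℝ) × (Fin 4 → ℝ) => p.1 i)
      ((ContinuousLinearMap.proj (R := ℝ) (φ := fun _ : Fin 4 => ℝ) i).comp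
        (ContinuousLinearMap.fst ℝ _ _)) (y, z) :=
    ((ContinuousLinearMap.proj (R := ℝ) (φ := fun _ : Fin 4 => ℝ) i).comp
      (ContinuousLinearMap.fst ℝ (Fin 4 → ℝ) (Fin 4 → ℝ))).hasFDerivAt
  have hZ (i : Fin 4) : HasFDerivAt (fun p : (Fin 4 → ℝ) × (Fin 4 → ℝ) => p.2 i)
      ((ContinuousLinearMap.proj (R := ℝ) (φ := fun _ : Fin 4 => ℝ) i).comp
        (ContinuousLinearMap.snd ℝ _ _)) (y, z) :=
    ((ContinuousLinearMap.proj (R := ℝ) (φ := fun _ : Fin 4 => ℝ) i).comp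
      (ContinuousLinearMap.snd ℝ (Fin 4 → ℝ) (Fin 4 → ℝ))).hasFDerivAt
  have hc := ((hY 3).const_mul η).cos
  have hs := ((hY 3).const_mul η).sin
  have h0 := (hY 0).add (hZ 0)
  have h1 := ((hY 1).add ((hZ 1).mul hc)).add ((hZ 2).mul hs)
  have h2 := ((hY 2).sub ((hZ 1).mul hs)).add ((hZ 2).mul hc)
  have h3 := (hY 3).add (hZ 3)
  have hcomponent (i : Fin 4) : ∃ L : (Fin 4 → ℝ) × (Fin 4 → ℝ) →L[ℝ] ℝ,
      HasFDerivAt (fun p : (Fin 4 → ℝ) × (Fin 4 → ℝ) => mulEta η p.1 p.2 i) L (y, z) ∧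
      ∀ d, L (pbasis d) = mulEtaJacobian η y z i d := by
    fin_cases i
    on_goal 1 => refine ⟨_, h0, ?_⟩
    on_goal 2 => refine ⟨_, h1, ?_⟩
    on_goal 3 => refine ⟨_, h2, ?_⟩
    on_goal 4 => refine ⟨_, h3, ?_⟩
    all_goals
      rintro (d | d) <;> fin_cases d <;> simp [pbasis, mulEtaJacobian] <;> ring
  choose L hL hJ using hcomponent
  exact ⟨ContinuousLinearMap.pi L, hasFDerivAt_pi.2 hL, hJ⟩

/-- The chain rule for coproducts. -/
theorem gradProd_coproduct {η : ℝ} {y z : Fin 4 → ℝ} {H : (Fin 4 → ℝ) → ℝ}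
    {L : (Fin 4 → ℝ) →L[ℝ] ℝ} (hH : HasFDerivAt H L (mulEta η y z)) :
    gradProd (fun p => H (mulEta η p.1 p.2)) (y, z) =
      (fun i => L (Pi.single i 1)) ᵥ* mulEtaJacobian η y z := by
  obtain ⟨M, hM, hJ⟩ := hasFDerivAt_mulEta η y z
  have hcomp : HasFDerivAt (fun p : (Fin 4 → ℝ) × (Fin 4 → ℝ) => H (mulEta η p.1 p.2))
      (L.comp M) (y, z) := hH.comp (y, z) hM
  funext d
  rw [gradProd, hcomp.fderiv, ContinuousLinearMap.comp_apply,
    pi_eq_sum_univ' (M (pbasis d))]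
  simp [Matrix.vecMul, dotProduct, hJ, mul_comm]

theorem exists_hasFDerivAt_H0Eta {η : ℝ} (hη : η ≠ 0) (x : Fin 4 → ℝ) :
    ∃ L : (Fin 4 → ℝ) →L[ℝ] ℝ, HasFDerivAt (H0Eta η) L x ∧
      (fun i => L (Pi.single i 1)) =
        ![-2 * x 0, -((cos (η * x 3) - 1) / η), sin (η * x 3) / η,
          cos (η * x 3) * x 2 + sin (η * x 3) * x 1] := by
  have hX (i : Fin 4) : HasFDerivAt (fun p : Fin 4 → ℝ => p i)
      (ContinuousLinearMap.proj (R := ℝ) (φ := fun _ : Fin 4 => ℝ) i) x :=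
    hasFDerivAt_apply i x
  have hc := ((hX 3).const_mul η).cos
  have hs := ((hX 3).const_mul η).sin
  have h := (((hs.mul_const η⁻¹).mul (hX 2)).sub
    (((hc.sub_const 1).mul_const η⁻¹).mul (hX 1))).sub ((hX 0).pow 2)
  refine ⟨_, h, ?_⟩
  funext i
  fin_cases i <;> simp [div_eq_mul_inv]
  field_simp

theorem exists_hasFDerivAt_H1Eta (x : Fin 4 → ℝ) :
    ∃ L : (Fin 4 → ℝ) →L[ℝ] ℝ, HasFDerivAt H1Eta L x ∧
      (fun i => L (Pi.single i 1)) = ![0, 2 * x 1, 2 * x 2, 0] := by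
  have hX (i : Fin 4) : HasFDerivAt (fun p : Fin 4 → ℝ => p i)
      (ContinuousLinearMap.proj (R := ℝ) (φ := fun _ : Fin 4 => ℝ) i) x :=
    hasFDerivAt_apply i x
  refine ⟨_, ((hX 1).pow 2).add ((hX 2).pow 2), ?_⟩
  funext i
  fin_cases i <;> simp

/-- The group multiplication is a Poisson map for Π_{0η}. -/
theorem mulEtaJacobian_mul_Pi0Eta (η : ℝ) (y z : Fin 4 → ℝ) :
    mulEtaJacobian η y z * Matrix.fromBlocks (Pi0Eta η y) 0 0 (Pi0Eta η z) *
      (mulEtaJacobian η y z)ᵀ = Pi0Eta η (mulEta η y z) := by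
  rw [mulEtaJacobian, Matrix.transpose_fromCols, Matrix.fromCols_mul_fromBlocks,
    Matrix.fromCols_mul_fromRows]
  simp only [Matrix.mul_zero, add_zero, zero_add]
  ext i j
  simp only [Matrix.add_apply, Matrix.mul_apply, Fin.sum_univ_four, Matrix.transpose_apply]
  fin_cases i <;> fin_cases j <;>
    simp [Pi0Eta, mulEta] <;> ring

/-- The group multiplication is a Poisson map for Π_{1η}. -/
theorem mulEtaJacobian_mul_Pi1Eta (η : ℝ) (y z : Fin 4 → ℝ) :
    mulEtaJacobian η y z * Matrix.fromBlocks (Pi1Eta η y) 0 0 (Pi1Eta η z) *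
      (mulEtaJacobian η y z)ᵀ = Pi1Eta η (mulEta η y z) := by
  rw [mulEtaJacobian, Matrix.transpose_fromCols, Matrix.fromCols_mul_fromBlocks,
    Matrix.fromCols_mul_fromRows]
  simp only [Matrix.mul_zero, add_zero, zero_add]
  ext i j
  simp only [Matrix.add_apply, Matrix.mul_apply, Fin.sum_univ_four, Matrix.transpose_apply]
  fin_cases i <;> fin_cases j <;>
    simp [Pi1Eta, mulEta, mul_add, sin_add, cos_add] <;>
    first
    | ring1
    | linear_combination (-(z 0) / 2) * sin_sq_add_cos_sq (η * y 3)
    | linear_combination (z 0 / 2) * sin_sq_add_cos_sq (η * y 3)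

theorem vecMul_dotProduct_mulVec_vecMul {m n R : Type*} [Fintype m] [Fintype n] [CommRing R]
    (u v : m → R) (J : Matrix m n R) (P : Matrix n n R) :
    (u ᵥ* J) ⬝ᵥ (P *ᵥ (v ᵥ* J)) = u ⬝ᵥ ((J * P * Jᵀ) *ᵥ v) := by
  rw [← Matrix.mulVec_transpose J v, ← Matrix.dotProduct_mulVec, Matrix.mulVec_mulVec,
    Matrix.mulVec_mulVec, Matrix.mul_assoc]

/-- The coproducts H_{0η}∘m and H_{1η}∘m are in involution with respect to both
product Poisson structures Π_{0η} ⊕ Π_{0η} and Π_{1η} ⊕ Π_{1η} on ℝ⁴ × ℝ⁴. -/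
theorem coproducts_in_involution (η : ℝ) (hη : η ≠ 0) (y z : Fin 4 → ℝ) :
    dotProduct (gradProd (fun p => H0Eta η (mulEta η p.1 p.2)) (y, z))
      (Matrix.mulVec (Matrix.fromBlocks (Pi0Eta η y) 0 0 (Pi0Eta η z))
        (gradProd (fun p => H1Eta (mulEta η p.1 p.2)) (y, z))) = 0 ∧
    dotProduct (gradProd (fun p => H0Eta η (mulEta η p.1 p.2)) (y, z))
      (Matrix.mulVec (Matrix.fromBlocks (Pi1Eta η y) 0 0 (Pi1Eta η z))
        (gradProd (fun p => H1Eta (mulEta η p.1 p.2)) (y, z))) = 0 := by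
  obtain ⟨L, hL, hLv⟩ := exists_hasFDerivAt_H0Eta hη (mulEta η y z)
  obtain ⟨M, hM, hMv⟩ := exists_hasFDerivAt_H1Eta (mulEta η y z)
  rw [gradProd_coproduct hL, gradProd_coproduct hM, hLv, hMv,
    vecMul_dotProduct_mulVec_vecMul, vecMul_dotProduct_mulVec_vecMul,
    mulEtaJacobian_mul_Pi0Eta, mulEtaJacobian_mul_Pi1Eta]
  generalize mulEta η y z = x
  constructor
  · simp [Pi0Eta, dotProduct, Matrix.mulVec, Fin.sum_univ_four]
    right
    ring
  · simp [Pi1Eta, dotProduct, Matrix.mulVec, Fin.sum_univ_four]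
    field_simp
    ring
end

section
/- Fix a real η ≠ 0, and let m, Π_{0η}, Π_{1η}, H_{0η}, H_{1η} and F_η be as follows: m(y,z) = ( y₁+z₁, y₂ + z₂cos(ηy₄) + z₃sin(ηy₄), y₃ − z₂sin(ηy₄) + z₃cos(ηy₄), y₄+z₄ ); Π_{0η}, Π_{1η} are the antisymmetric 4×4 matrix-valued maps on ℝ^4 with nonzero upper-triangular entries (Π_{0η})_{12}(x) = −x₃/2, (Π_{0η})_{13}(x) = x₂/2 and (Π_{1η})_{12}(x) = sin(ηx₄)/(4η), (Π_{1η})_{13}(x) = (cos(ηx₄)−1)/(4η), (Π_{1η})_{23}(x) = −x₁/2; H_{0η}(x) = (sin(ηx₄)/η)x₃ − ((cos(ηx₄)−1)/η)x₂ − x₁², H_{1η}(x) = x₂² + x₃²; F_η(x) = ( (sin(ηx₄)/(2η))x₂ + ((cos(ηx₄)−1)/(2η))x₃, −x₁x₃, x₁x₂, 0 ). Then for i = 0 and i = 1 and all (y,z) ∈ ℝ^4 × ℝ^4, writing J(y,z) for the 4×8 Jacobian matrix of m at (y,z): J(y,z) · ( Π_{iη}(y) ⊕ Π_{iη}(z)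 ) · ∇(H_{iη}∘m)(y,z) = F_η( m(y,z) ). That is, the Hamiltonian system of H_{iη}∘m on ℝ^4 × ℝ^4 with respect to the product structure Π_{iη} ⊕ Π_{iη} projects under the multiplication m to the deformed bi-Hamiltonian system ẋ = F_η(x) on ℝ^4. -/
open Real Matrix

/-- The differential of the multiplication with respect to its first factor. -/
noncomputable def leftJacobian (η : ℝ) (y z : Fin 4 → ℝ) : Matrix (Fin 4) (Fin 4) ℝ :=
  !![1, 0, 0, 0;
     0, 1, 0, η * (z 2 * cos (η * y 3) - z 1 * sin (η * y 3));
     0, 0, 1, -(η * (z 1 * cos (η * y 3) + z 2 * sin (η * y 3)));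
     0, 0, 0, 1]

/-- The differential of the multiplication with respect to its second factor. -/
noncomputable def rightJacobian (η : ℝ) (y : Fin 4 → ℝ) : Matrix (Fin 4) (Fin 4) ℝ :=
  !![1, 0, 0, 0;
     0, cos (η * y 3), sin (η * y 3), 0;
     0, -sin (η * y 3), cos (η * y 3), 0;
     0, 0, 0, 1]

theorem differentiable_mulEta (η : ℝ) :
    Differentiable ℝ fun p : (Fin 4 → ℝ) × (Fin 4 → ℝ) => mulEta η p.1 p.2 := by
  rw [differentiable_pi]
  intro i
  fin_cases i <;> simp [mulEta] <;> fun_prop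

theorem hasFDerivAt_fst_apply (p : (Fin 4 → ℝ) × (Fin 4 → ℝ)) (j : Fin 4) :
    HasFDerivAt (fun q : (Fin 4 → ℝ) × (Fin 4 → ℝ) => q.1 j)
      ((ContinuousLinearMap.proj j).comp (ContinuousLinearMap.fst ℝ _ _) :
        (Fin 4 → ℝ) × (Fin 4 → ℝ) →L[ℝ] ℝ) p :=
  ((ContinuousLinearMap.proj j).comp (ContinuousLinearMap.fst ℝ (Fin 4 → ℝ) (Fin 4 → ℝ)) :
    (Fin 4 → ℝ) × (Fin 4 → ℝ) →L[ℝ] ℝ).hasFDerivAt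

theorem hasFDerivAt_snd_apply (p : (Fin 4 → ℝ) × (Fin 4 → ℝ)) (j : Fin 4) :
    HasFDerivAt (fun q : (Fin 4 → ℝ) × (Fin 4 → ℝ) => q.2 j)
      ((ContinuousLinearMap.proj j).comp (ContinuousLinearMap.snd ℝ _ _) :
        (Fin 4 → ℝ) × (Fin 4 → ℝ) →L[ℝ] ℝ) p :=
  ((ContinuousLinearMap.proj j).comp (ContinuousLinearMap.snd ℝ (Fin 4 → ℝ) (Fin 4 → ℝ)) :
    (Fin 4 → ℝ) × (Fin 4 → ℝ) →L[ℝ] ℝ).hasFDerivAt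

theorem jacMul_eq_fromCols_s12 (η : ℝ) (y z : Fin 4 → ℝ) :
    jacMul η y z = fromCols (leftJacobian η y z) (rightJacobian η y) := by
  have hy := hasFDerivAt_fst_apply (y, z)
  have hz := hasFDerivAt_snd_apply (y, z)
  have hθ := (hy 3).const_mul η
  have h0 := (hy 0).add (hz 0)
  have h1 := ((hy 1).add ((hz 1).mul hθ.cos)).add ((hz 2).mul hθ.sin)
  have h2 := ((hy 2).sub ((hz 1).mul hθ.sin)).add ((hz 2).mul hθ.cos)
  have h3 := (hy 3).add (hz 3)
  ext i d
  fin_cases i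
  · refine (congrArg (fun L => L (pbasis d)) h0.fderiv).trans ?_
    rcases d with j | j <;> fin_cases j <;> simp [pbasis, leftJacobian, rightJacobian]
  · refine (congrArg (fun L => L (pbasis d)) h1.fderiv).trans ?_
    rcases d with j | j <;> fin_cases j <;> simp [pbasis, leftJacobian, rightJacobian]
    ring
  · refine (congrArg (fun L => L (pbasis d)) h2.fderiv).trans ?_
    rcases d with j | j <;> fin_cases j <;> simp [pbasis, leftJacobian, rightJacobian]
    ring
  · refine (congrArg (fun L => L (pbasis d)) h3.fderiv).trans ?_
    rcases d with j | j <;> fin_cases j <;> simp [pbasis, leftJacobian, rightJacobian]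

/-- The chain rule for the gradient of a function pulled back along the multiplication. -/
theorem gradProd_comp_mulEta (η : ℝ) (y z : Fin 4 → ℝ) {K : (Fin 4 → ℝ) → ℝ}
    (hK : DifferentiableAt ℝ K (mulEta η y z)) :
    gradProd (fun p => K (mulEta η p.1 p.2)) (y, z) =
      (jacMul η y z)ᵀ *ᵥ fun k => fderiv ℝ K (mulEta η y z) (Pi.single k 1) := by
  ext d
  have hm := differentiable_mulEta η (y, z)
  have hcomp := HasFDerivAt.comp (y, z)
    (f := fun p : (Fin 4 → ℝ) × (Fin 4 → ℝ) => mulEta η p.1 p.2)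
    hK.hasFDerivAt hm.hasFDerivAt
  have hcoord (k : Fin 4) := fderiv_apply
    (Φ := fun p : (Fin 4 → ℝ) × (Fin 4 → ℝ) => mulEta η p.1 p.2) (x := (y, z)) hm k
  refine (congrArg (fun L => L (pbasis d)) hcomp.fderiv).trans ?_
  set v := fderiv ℝ (fun p : (Fin 4 → ℝ) × (Fin 4 → ℝ) => mulEta η p.1 p.2) (y, z) (pbasis d)
    with hv
  have hjac (k : Fin 4) : jacMul η y z k d = v k := by
    simp [jacMul, hcoord, hv]
  have hsingle (k : Fin 4) : (fun j => if k = j then (1 : ℝ) else 0) = Pi.single k 1 := by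
    ext j
    simp [Pi.single_apply, eq_comm]
  rw [ContinuousLinearMap.comp_apply, ← hv, ← ContinuousLinearMap.coe_coe,
    LinearMap.pi_apply_eq_sum_univ]
  simp [mulVec, dotProduct, hjac, hsingle]

/-- If the multiplication is a Poisson map for `P`, the Hamiltonian vector field of a pulled back
function pushes forward to the Hamiltonian vector field of that function. -/
theorem jacMul_mulVec_hamiltonian (η : ℝ) (y z : Fin 4 → ℝ)
    {P : (Fin 4 → ℝ) → Matrix (Fin 4) (Fin 4) ℝ} {K : (Fin 4 → ℝ) → ℝ}
    (hK : DifferentiableAt ℝ K (mulEta η y z))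
    (hP : leftJacobian η y z * P y * (leftJacobian η y z)ᵀ +
      rightJacobian η y * P z * (rightJacobian η y)ᵀ = P (mulEta η y z)) :
    jacMul η y z *ᵥ (fromBlocks (P y) 0 0 (P z) *ᵥ
        gradProd (fun p => K (mulEta η p.1 p.2)) (y, z)) =
      P (mulEta η y z) *ᵥ fun k => fderiv ℝ K (mulEta η y z) (Pi.single k 1) := by
  rw [gradProd_comp_mulEta η y z hK, mulVec_mulVec, mulVec_mulVec, ← hP, jacMul_eq_fromCols_s12,
    transpose_fromCols, fromCols_mul_fromBlocks, fromCols_mul_fromRows]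
  simp

theorem poisson_Pi0Eta (η : ℝ) (y z : Fin 4 → ℝ) :
    leftJacobian η y z * Pi0Eta η y * (leftJacobian η y z)ᵀ +
      rightJacobian η y * Pi0Eta η z * (rightJacobian η y)ᵀ = Pi0Eta η (mulEta η y z) := by
  ext i j
  fin_cases i <;> fin_cases j <;>
    simp only [Matrix.add_apply, Matrix.mul_apply, Fin.sum_univ_four, transpose_apply] <;>
    simp [leftJacobian, rightJacobian, Pi0Eta, mulEta] <;>
    ring

theorem poisson_Pi1Eta (η : ℝ) (y z : Fin 4 → ℝ) :
    leftJacobian η y z * Pi1Eta η y * (leftJacobian η y z)ᵀ +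
      rightJacobian η y * Pi1Eta η z * (rightJacobian η y)ᵀ = Pi1Eta η (mulEta η y z) := by
  have h := sin_sq_add_cos_sq (η * y 3)
  ext i j
  fin_cases i <;> fin_cases j <;>
    simp only [Matrix.add_apply, Matrix.mul_apply, Fin.sum_univ_four, transpose_apply] <;>
    simp [leftJacobian, rightJacobian, Pi1Eta, mulEta, mul_add, sin_add, cos_add] <;>
    first
    | ring1
    | linear_combination (-(z 0) / 2) * h
    | linear_combination (z 0 / 2) * h

theorem differentiableAt_H0Eta (η : ℝ) (x : Fin 4 → ℝ) :
    DifferentiableAt ℝ (H0Eta η) x := by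
  unfold H0Eta
  fun_prop

theorem differentiableAt_H1Eta (x : Fin 4 → ℝ) : DifferentiableAt ℝ H1Eta x := by
  unfold H1Eta
  fun_prop

theorem Pi0Eta_mulVec_gradient (η : ℝ) (hη : η ≠ 0) (x : Fin 4 → ℝ) :
    (Pi0Eta η x *ᵥ fun k => fderiv ℝ (H0Eta η) x (Pi.single k 1)) = FEta η x := by
  have hx (j : Fin 4) : HasFDerivAt (fun q : Fin 4 → ℝ => q j)
      (ContinuousLinearMap.proj j : (Fin 4 → ℝ) →L[ℝ] ℝ) x := hasFDerivAt_apply j x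
  have hθ := (hx 3).const_mul η
  have h : HasFDerivAt (H0Eta η) _ x :=
    (((hθ.sin.mul_const η⁻¹).mul (hx 2)).sub
      (((hθ.cos.sub_const 1).mul_const η⁻¹).mul (hx 1))).sub ((hx 0).pow 2)
  ext i
  rw [h.fderiv]
  fin_cases i <;>
    simp [Pi0Eta, FEta, mulVec, dotProduct, Fin.sum_univ_four] <;>
    field_simp
  ring

theorem Pi1Eta_mulVec_gradient (η : ℝ) (x : Fin 4 → ℝ) :
    (Pi1Eta η x *ᵥ fun k => fderiv ℝ H1Eta x (Pi.single k 1)) = FEta η x := by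
  have hx (j : Fin 4) : HasFDerivAt (fun q : Fin 4 → ℝ => q j)
      (ContinuousLinearMap.proj j : (Fin 4 → ℝ) →L[ℝ] ℝ) x := hasFDerivAt_apply j x
  have h : HasFDerivAt H1Eta _ x := ((hx 1).pow 2).add ((hx 2).pow 2)
  ext i
  rw [h.fderiv]
  fin_cases i <;>
    simp [Pi1Eta, FEta, mulVec, dotProduct, Fin.sum_univ_four] <;>
    ring

/-- For i = 0 and i = 1, the Hamiltonian system of H_{iη}∘m on ℝ⁴ × ℝ⁴ with
respect to the product structure Π_{iη} ⊕ Π_{iη} projects, under the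
multiplication m, to the deformed bi-Hamiltonian system ẋ = F_η(x) on ℝ⁴. -/
theorem coupled_systems_reduce (η : ℝ) (hη : η ≠ 0) (y z : Fin 4 → ℝ) :
    Matrix.mulVec (jacMul η y z)
      (Matrix.mulVec (Matrix.fromBlocks (Pi0Eta η y) 0 0 (Pi0Eta η z))
        (gradProd (fun p => H0Eta η (mulEta η p.1 p.2)) (y, z)))
      = FEta η (mulEta η y z) ∧
    Matrix.mulVec (jacMul η y z)
      (Matrix.mulVec (Matrix.fromBlocks (Pi1Eta η y) 0 0 (Pi1Eta η z))
        (gradProd (fun p => H1Eta (mulEta η p.1 p.2)) (y, z)))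
      = FEta η (mulEta η y z) := by
  exact ⟨(jacMul_mulVec_hamiltonian η y z (differentiableAt_H0Eta η _)
      (poisson_Pi0Eta η y z)).trans (Pi0Eta_mulVec_gradient η hη _),
    (jacMul_mulVec_hamiltonian η y z (differentiableAt_H1Eta _)
      (poisson_Pi1Eta η y z)).trans (Pi1Eta_mulVec_gradient η _)⟩
end
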